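/- arXiv:1409.0341 — 3 statements merged into one kernel-verified Lean document; each statement's English description precedes it below -/
import Mathlib

section
/- Let d ≥ 1, N ≥ 1, and let (q_y = 1/N, π_y)_{y=1}^N be a uniformly distributed 2-design in dimension d. Then for every nonzero positive semidefinite d×d complex matrix ρ with Tr[ρ] ≤ 1, the Shannon entropy of the probability distribution q_{y|ρ} := (d/N)·⟨π_y, ρ π_y⟩ / Tr[ρ] satisfies H ≥ log₂( N(d+1)/(2d) ); i.e., the state-dependent entropy lower bound log₂( (N(d+1)/d)·Tr[ρ]²/(Tr[ρ]² + Tr[ρ²]) ) is minimized exactly when ρ is proportional to a rank-one projection, where it equals log₂( N(d+1)/(2d) ). -/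
open Matrix Finset
open scoped Kronecker BigOperators ComplexOrder

/-- The rank-one operator `|φ⟩⟨φ|` associated to a vector `φ : Fin d → ℂ`. -/
noncomputable def outerProd {d : ℕ} (φ : Fin d → ℂ) : Matrix (Fin d) (Fin d) ℂ :=
  Matrix.vecMulVec φ (star φ)

/-- The swap operator `S` on `ℂ^d ⊗ ℂ^d`, determined by `S (u ⊗ v) = v ⊗ u`. -/
noncomputable def swapMatrix (d : ℕ) : Matrix (Fin d × Fin d) (Fin d × Fin d) ℂ :=
  Matrix.of fun p q => if p.1 = q.2 ∧ p.2 = q.1 then 1 else 0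

/-- `(p, φ)` is a spherical quantum 2-design in dimension `d`: the `φ x` are unit
vectors, the weights `p x` are nonnegative and sum to one, and
`Σ_x p_x (|φ_x⟩⟨φ_x|)^{⊗2} = (I + S)/(d(d+1))`. -/
noncomputable def IsTwoDesign {d N : ℕ} (p : Fin N → ℝ) (φ : Fin N → Fin d → ℂ) : Prop :=
  (∀ x, 0 ≤ p x) ∧ (∑ x, p x = 1) ∧ (∀ x, star (φ x) ⬝ᵥ φ x = 1) ∧
  (∑ x, (p x : ℂ) • (outerProd (φ x) ⊗ₖ outerProd (φ x))
      = (((d : ℂ) * ((d : ℂ) + 1))⁻¹) • (1 + swapMatrix d))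

/-- The Shannon entropy of a probability vector is at least its collision entropy. -/
theorem logb_inv_le_entropy_of_sum_sq_le {ι : Type*} [Fintype ι] {r : ι → ℝ} {s : ℝ}
    (hr : ∀ i, 0 ≤ r i) (hsum : ∑ i, r i = 1) (hs : 0 < s) (hsq : ∑ i, r i ^ 2 ≤ s) :
    Real.logb 2 s⁻¹ ≤ -∑ i, r i * Real.logb 2 (r i) := by
  have key : ∑ i, r i * Real.log (r i) ≤ Real.log s := by
    have hterm : ∀ i, r i * Real.log (r i) ≤ r i ^ 2 / s - r i + r i * Real.log s := by
      intro i
      rcases (hr i).eq_or_lt with h | h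
      · simp [← h]
      · have h1 := Real.log_le_sub_one_of_pos (div_pos h hs)
        rw [Real.log_div h.ne' hs.ne'] at h1
        have h2 := mul_le_mul_of_nonneg_left h1 h.le
        have h3 : r i * (r i / s - 1) = r i ^ 2 / s - r i := by ring
        linarith
    calc ∑ i, r i * Real.log (r i) ≤ ∑ i, (r i ^ 2 / s - r i + r i * Real.log s) :=
          Finset.sum_le_sum fun i _ => hterm i
      _ = (∑ i, r i ^ 2) / s - 1 + Real.log s := by
          rw [Finset.sum_add_distrib, Finset.sum_sub_distrib, ← Finset.sum_div,
            ← Finset.sum_mul, hsum, one_mul]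
      _ ≤ Real.log s := by
          have := (div_le_one hs).2 hsq
          linarith
  have hlog2 : 0 < Real.log 2 := Real.log_pos (by norm_num)
  simp only [Real.logb, Real.log_inv, ← mul_div_assoc, ← Finset.sum_div, ← neg_div]
  gcongr

theorem trace_outerProd_mul {d : ℕ} (φ : Fin d → ℂ) (A : Matrix (Fin d) (Fin d) ℂ) :
    (outerProd φ * A).trace = star φ ⬝ᵥ A *ᵥ φ := by
  rw [outerProd, vecMulVec_mul, trace_vecMulVec, dotProduct_comm, dotProduct_mulVec]

theorem trace_swapMatrix_mul_kronecker {d : ℕ} (A B : Matrix (Fin d) (Fin d) ℂ) :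
    (swapMatrix d * (A ⊗ₖ B)).trace = (A * B).trace := by
  simp only [swapMatrix, trace, Matrix.diag, mul_apply, kroneckerMap_apply, of_apply,
    Fintype.sum_prod_type, ite_mul, one_mul, zero_mul, ite_and]
  simp only [Finset.sum_ite_eq, Finset.mem_univ, if_true]
  rw [Finset.sum_comm]

theorem IsTwoDesign.sum_mul_expectation {d N : ℕ} {p : Fin N → ℝ} {φ : Fin N → Fin d → ℂ}
    (h : IsTwoDesign p φ) (A B : Matrix (Fin d) (Fin d) ℂ) :
    ∑ x, (p x : ℂ) * ((star (φ x) ⬝ᵥ A *ᵥ φ x) * (star (φ x) ⬝ᵥ B *ᵥ φ x)) =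
      ((d : ℂ) * (d + 1))⁻¹ * (A.trace * B.trace + (A * B).trace) := by
  have h1 := congrArg (fun M => (M * (A ⊗ₖ B)).trace) h.2.2.2
  simpa [Finset.sum_mul, trace_sum, ← mul_kronecker_mul, trace_kronecker, trace_outerProd_mul,
    add_mul, trace_swapMatrix_mul_kronecker, mul_add] using h1

theorem IsTwoDesign.sum_expectation {d N : ℕ} {p : Fin N → ℝ} {φ : Fin N → Fin d → ℂ}
    (h : IsTwoDesign p φ) (A : Matrix (Fin d) (Fin d) ℂ) :
    ∑ x, (p x : ℂ) * (star (φ x) ⬝ᵥ A *ᵥ φ x) = (d : ℂ)⁻¹ * A.trace := by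
  have h1 := h.sum_mul_expectation A 1
  have hd : (d : ℂ) + 1 ≠ 0 := by exact_mod_cast d.succ_ne_zero
  simp only [one_mulVec, h.2.2.1, mul_one, trace_one, Fintype.card_fin] at h1
  rw [h1]
  field_simp

section Spectral

variable {d : ℕ} {ρ : Matrix (Fin d) (Fin d) ℂ}

theorem Matrix.IsHermitian.trace_re_eq_sum_eigenvalues (hρ : ρ.IsHermitian) :
    ρ.trace.re = ∑ i, hρ.eigenvalues i := by
  simp [hρ.trace_eq_sum_eigenvalues]

theorem Matrix.IsHermitian.trace_mul_self_re (hρ : ρ.IsHermitian) :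
    (ρ * ρ).trace.re = ∑ i, hρ.eigenvalues i ^ 2 := by
  have h : ρ * ρ = hρ.eigenvectorUnitary.1 *
      diagonal (fun i => (hρ.eigenvalues i : ℂ) ^ 2) * star hρ.eigenvectorUnitary.1 := by
    conv_lhs => rw [hρ.spectral_theorem, ← map_mul, Unitary.conjStarAlgAut_apply]
    simp [diagonal_mul_diagonal, sq]
  rw [h, trace_mul_comm, ← mul_assoc, Unitary.coe_star_mul_self, one_mul, trace_diagonal,
    Complex.re_sum]
  exact Finset.sum_congr rfl fun i _ => by norm_cast

theorem Matrix.PosSemidef.trace_mul_self_re_le (hρ : ρ.PosSemidef) :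
    (ρ * ρ).trace.re ≤ ρ.trace.re ^ 2 := by
  rw [hρ.1.trace_mul_self_re, hρ.1.trace_re_eq_sum_eigenvalues]
  exact Finset.sum_sq_le_sq_sum_of_nonneg fun i _ => hρ.eigenvalues_nonneg i

theorem Matrix.PosSemidef.trace_re_pos (hρ : ρ.PosSemidef) (hne : ρ ≠ 0) :
    0 < ρ.trace.re := by
  have h := (hρ.trace_nonneg.lt_of_ne' fun h => hne (hρ.trace_eq_zero_iff.1 h))
  exact (Complex.lt_def.1 h).1

/-- A nonzero positive semidefinite matrix is pure iff its purity is the square of its trace. -/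
theorem Matrix.PosSemidef.trace_mul_self_re_eq_iff (hρ : ρ.PosSemidef) (hne : ρ ≠ 0) :
    (ρ * ρ).trace.re = ρ.trace.re ^ 2 ↔
      ∃ (c : ℝ) (ψ : Fin d → ℂ), 0 < c ∧ star ψ ⬝ᵥ ψ = 1 ∧ ρ = (c : ℂ) • outerProd ψ := by
  constructor
  · intro h
    have hpos := hρ.trace_re_pos hne
    rw [hρ.1.trace_re_eq_sum_eigenvalues] at hpos
    rw [hρ.1.trace_mul_self_re, hρ.1.trace_re_eq_sum_eigenvalues] at h
    set l := hρ.1.eigenvalues with hl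
    have hl0 : ∀ i, 0 ≤ l i := hρ.eigenvalues_nonneg
    obtain ⟨k, -, hk⟩ := Finset.exists_lt_of_sum_lt (s := Finset.univ) (f := fun _ => (0 : ℝ))
      (g := l) (by simpa using hpos)
    have hle : ∀ i, l i ≤ ∑ j, l j := fun i =>
      Finset.single_le_sum (fun j _ => hl0 j) (Finset.mem_univ i)
    have hzero : ∑ i, l i * (∑ j, l j - l i) = 0 := by
      simp only [mul_sub, Finset.sum_sub_distrib, ← Finset.sum_mul, ← sq, h, sub_self]
    rw [Finset.sum_eq_zero_iff_of_nonneg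
      fun i _ => mul_nonneg (hl0 i) (sub_nonneg.2 (hle i))] at hzero
    have hsum : ∑ j, l j = l k :=
      sub_eq_zero.1 ((mul_eq_zero.1 (hzero k (Finset.mem_univ k))).resolve_left hk.ne')
    have hother : ∀ i, i ≠ k → l i = 0 := by
      rw [← Finset.add_sum_erase _ _ (Finset.mem_univ k), add_eq_left,
        Finset.sum_eq_zero_iff_of_nonneg fun i _ => hl0 i] at hsum
      exact fun i hi => hsum i (Finset.mem_erase.2 ⟨hi, Finset.mem_univ i⟩)
    refine ⟨l k, fun i => hρ.1.eigenvectorUnitary.1 i k, hk, ?_, ?_⟩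
    · have h1 := congrFun (congrFun (Unitary.coe_star_mul_self hρ.1.eigenvectorUnitary) k) k
      simpa [mul_apply, dotProduct] using h1
    · ext i j
      conv_lhs => rw [hρ.1.spectral_theorem, Unitary.conjStarAlgAut_apply]
      rw [mul_apply, Finset.sum_eq_single k]
      · simp [mul_diagonal, outerProd, vecMulVec_apply, ← hl]
        ring
      · intro b _ hb
        simp [mul_diagonal, ← hl, hother b hb]
      · simp
  · rintro ⟨c, ψ, -, hψ, rfl⟩
    have h1 : (outerProd ψ).trace = 1 := by
      rw [outerProd, trace_vecMulVec, dotProduct_comm, hψ]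
    have h2 : (outerProd ψ * outerProd ψ).trace = 1 := by
      rw [trace_outerProd_mul, outerProd, vecMulVec_mulVec]
      simp [hψ]
    simp [h1, h2, sq]

end Spectral

/-- State-independent entropic bound for uniformly distributed 2-design POVMs:
for every nonzero state `ρ` the Shannon entropy of `q_{y|ρ}` is at least
`log₂(N(d+1)/(2d))`; indeed the state-dependent lower bound
`log₂((N(d+1)/d)·Tr[ρ]²/(Tr[ρ]² + Tr[ρ²]))` is at least `log₂(N(d+1)/(2d))`,
with equality exactly when `ρ` is proportional to a rank-one projection. -/
theorem entropy_bound_two_design_povm_state_independent {d N : ℕ} (hd : 1 ≤ d) (hN : 1 ≤ N)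
    (q : Fin N → ℝ) (π : Fin N → Fin d → ℂ)
    (hdesign : IsTwoDesign q π) (hunif : ∀ y, q y = 1 / N)
    (ρ : Matrix (Fin d) (Fin d) ℂ) (hρ : ρ.PosSemidef) (hρtr : ρ.trace ≤ 1)
    (hρne : ρ ≠ 0) :
    (-∑ y, (((d : ℝ) / N) * (star (π y) ⬝ᵥ ρ.mulVec (π y)).re / ρ.trace.re) *
        Real.logb 2 (((d : ℝ) / N) * (star (π y) ⬝ᵥ ρ.mulVec (π y)).re / ρ.trace.re)
      ≥ Real.logb 2 ((N : ℝ) * ((d : ℝ) + 1) / (2 * (d : ℝ)))) ∧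
    (Real.logb 2 (((N : ℝ) * ((d : ℝ) + 1) / (d : ℝ)) * ρ.trace.re ^ 2 /
        (ρ.trace.re ^ 2 + (ρ * ρ).trace.re))
      ≥ Real.logb 2 ((N : ℝ) * ((d : ℝ) + 1) / (2 * (d : ℝ)))) ∧
    (Real.logb 2 (((N : ℝ) * ((d : ℝ) + 1) / (d : ℝ)) * ρ.trace.re ^ 2 /
        (ρ.trace.re ^ 2 + (ρ * ρ).trace.re))
      = Real.logb 2 ((N : ℝ) * ((d : ℝ) + 1) / (2 * (d : ℝ)))
      ↔ ∃ (c : ℝ) (ψ : Fin d → ℂ), 0 < c ∧ star ψ ⬝ᵥ ψ = 1 ∧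
          ρ = (c : ℂ) • outerProd ψ) := by
  have hdR : (0 : ℝ) < d := by exact_mod_cast hd
  have hNR : (0 : ℝ) < N := by exact_mod_cast hN
  have ht := hρ.trace_re_pos hρne
  have hle := hρ.trace_mul_self_re_le
  have hpure := hρ.trace_mul_self_re_eq_iff hρne
  have hτ : 0 ≤ (ρ * ρ).trace.re := by
    rw [hρ.1.trace_mul_self_re]
    exact Finset.sum_nonneg fun i _ => sq_nonneg _
  have he0 : ∀ y, 0 ≤ (star (π y) ⬝ᵥ ρ *ᵥ π y).re := fun y => hρ.re_dotProduct_nonneg (π y)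
  have him : ∀ y, (star (π y) ⬝ᵥ ρ *ᵥ π y).im = 0 := fun y =>
    (Complex.le_def.1 (hρ.dotProduct_mulVec_nonneg (π y))).2.symm
  have htim : ρ.trace.im = 0 := (Complex.le_def.1 hρ.trace_nonneg).2.symm
  have hfirst : ∑ y, (star (π y) ⬝ᵥ ρ *ᵥ π y).re = N * ρ.trace.re / d := by
    have h := congrArg Complex.re (hdesign.sum_expectation ρ)
    rw [← Complex.ofReal_natCast, ← Complex.ofReal_inv, Complex.re_ofReal_mul, Complex.re_sum]
      at h
    simp only [Complex.re_ofReal_mul, hunif, ← Finset.mul_sum] at h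
    field_simp at h ⊢
    linarith
  have hsecond : ∑ y, (star (π y) ⬝ᵥ ρ *ᵥ π y).re ^ 2 =
      N * (ρ.trace.re ^ 2 + (ρ * ρ).trace.re) / (d * (d + 1)) := by
    have h := congrArg Complex.re (hdesign.sum_mul_expectation ρ ρ)
    have hc : ((d : ℂ) * (d + 1))⁻¹ = (((d : ℝ) * (d + 1))⁻¹ : ℝ) := by push_cast; rfl
    rw [hc, Complex.re_ofReal_mul, Complex.re_sum] at h
    simp only [Complex.re_ofReal_mul] at h
    simp only [Complex.mul_re, Complex.add_re, him, htim, hunif, ← Finset.mul_sum, mul_zero,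
      sub_zero] at h
    simp only [sq]
    generalize (ρ * ρ).trace.re = τ at *
    field_simp at h ⊢
    linarith
  generalize ρ.trace.re = t at *
  generalize (ρ * ρ).trace.re = τ at *
  have hrhs : (N : ℝ) * (d + 1) / (2 * d) = N * (d + 1) / d * t ^ 2 / (t ^ 2 + t ^ 2) := by
    field_simp
    ring
  have hmono : (N : ℝ) * (d + 1) / (2 * d) ≤ N * (d + 1) / d * t ^ 2 / (t ^ 2 + τ) := by
    rw [hrhs]
    gcongr
  refine ⟨?_, Real.logb_le_logb_of_le (by norm_num) (by positivity) hmono, ?_⟩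
  · rw [ge_iff_le, ← inv_inv ((N : ℝ) * (d + 1) / (2 * d))]
    refine logb_inv_le_entropy_of_sum_sq_le
      (r := fun y => (d : ℝ) / N * (star (π y) ⬝ᵥ ρ *ᵥ π y).re / t) ?_ ?_ (by positivity) ?_
    · intro y
      have := he0 y
      positivity
    · rw [← Finset.sum_div, ← Finset.mul_sum, hfirst]
      field_simp
    · simp only [div_pow, mul_pow, ← Finset.sum_div, ← Finset.mul_sum, hsecond]
      field_simp
      linarith
  · rw [← hpure, (Real.logb_injOn_pos (by norm_num)).eq_iff (by simp only [Set.mem_Ioi]; positivity)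
      (by simp only [Set.mem_Ioi]; positivity), hrhs,
      div_eq_div_iff (by positivity) (by positivity), mul_right_inj' (by positivity),
      add_right_inj, eq_comm]
end

section
/- Let ω = e^{2πi/3} and ξ = e^{iπ/3}. Let F be the ensemble in dimension 3 consisting of the 9 states (1/9)|ψ_y⟩⟨ψ_y|, where the ψ_y are the unit vectors (1/√2)(0,−1,1), (1/√2)(0,ξ,1), (1/√2)(0,ξ*,1), (1/√2)(1,0,−1), (1/√2)(1,0,ξ), (1/√2)(1,0,ξ*), (1/√2)(−1,1,0), (1/√2)(ξ,1,0), (1/√2)(ξ*,1,0) (a SIC ensemble in dimension 3). Let P be the POVM consisting of the 12 effects (1/4)|φ_x⟩⟨φ_x|, where the φ_x are the unit vectors e₁, e₂, e₃ and (1/√3)(1,1,1), (1/√3)(1,ω,ω²), (1/√3)(1,ω²,ω), (1/√3)(1,ω,ω), (1/√3)(1,ω²,1), (1/√3)(1,1,ω²), (1/√3)(1,ω²,ω²), (1/√3)(1,ω,1), (1/√3)(1,1,ω) (the 4-MUB POVM in dimension 3). Then the mutual information equals exactly I(F, P) = log₂(3/2); combined with the 2-design upper bound this shows the informational power of the 3-dimensional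 4-MUB POVM is exactly log₂(3/2). -/
open Matrix Finset
open scoped BigOperators ComplexOrder

/-- The mutual information (in bits) of a finite joint probability distribution
`p : X → Y → ℝ`, with the convention `0·log₂ 0 = 0` (terms with `p x y = 0` vanish). -/
noncomputable def mutualInfo {X Y : Type*} [Fintype X] [Fintype Y] (p : X → Y → ℝ) : ℝ :=
  ∑ x, ∑ y, p x y * Real.logb 2 (p x y / ((∑ y', p x y') * (∑ x', p x' y)))

/-- `ω = e^{2πi/3}`. -/
noncomputable def ω : ℂ := Complex.exp (2 * Real.pi * Complex.I / 3)

/-- `ξ = e^{iπ/3}`. -/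
noncomputable def ξ : ℂ := Complex.exp (Real.pi * Complex.I / 3)

/-- The 12 unit vectors of the (unique) maximal set of 4 mutually unbiased bases in
dimension 3. -/
noncomputable def mub3Vecs : Fin 12 → Fin 3 → ℂ :=
  ![![1, 0, 0], ![0, 1, 0], ![0, 0, 1],
    ((Real.sqrt 3 : ℂ))⁻¹ • ![1, 1, 1],
    ((Real.sqrt 3 : ℂ))⁻¹ • ![1, ω, ω ^ 2],
    ((Real.sqrt 3 : ℂ))⁻¹ • ![1, ω ^ 2, ω],
    ((Real.sqrt 3 : ℂ))⁻¹ • ![1, ω, ω],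
    ((Real.sqrt 3 : ℂ))⁻¹ • ![1, ω ^ 2, 1],
    ((Real.sqrt 3 : ℂ))⁻¹ • ![1, 1, ω ^ 2],
    ((Real.sqrt 3 : ℂ))⁻¹ • ![1, ω ^ 2, ω ^ 2],
    ((Real.sqrt 3 : ℂ))⁻¹ • ![1, ω, 1],
    ((Real.sqrt 3 : ℂ))⁻¹ • ![1, 1, ω]]

/-- The 9 unit vectors of a symmetric informationally complete (SIC) set in dimension 3. -/
noncomputable def sic3Vecs : Fin 9 → Fin 3 → ℂ :=
  ![((Real.sqrt 2 : ℂ))⁻¹ • ![0, -1, 1],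
    ((Real.sqrt 2 : ℂ))⁻¹ • ![0, ξ, 1],
    ((Real.sqrt 2 : ℂ))⁻¹ • ![0, (starRingEnd ℂ) ξ, 1],
    ((Real.sqrt 2 : ℂ))⁻¹ • ![1, 0, -1],
    ((Real.sqrt 2 : ℂ))⁻¹ • ![1, 0, ξ],
    ((Real.sqrt 2 : ℂ))⁻¹ • ![1, 0, (starRingEnd ℂ) ξ],
    ((Real.sqrt 2 : ℂ))⁻¹ • ![-1, 1, 0],
    ((Real.sqrt 2 : ℂ))⁻¹ • ![ξ, 1, 0],
    ((Real.sqrt 2 : ℂ))⁻¹ • ![(starRingEnd ℂ) ξ, 1, 0]]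

theorem trace_outerProd_mul_outerProd {d : ℕ} (φ ψ : Fin d → ℂ) :
    (outerProd φ * outerProd ψ).trace = (Complex.normSq (φ ⬝ᵥ star ψ) : ℂ) := by
  rw [outerProd, outerProd, vecMulVec_mul_vecMulVec, trace_vecMulVec, dotProduct_smul, smul_eq_mul,
    Complex.normSq_eq_conj_mul_self, dotProduct_comm φ (star ψ)]
  congr 1
  rw [← Complex.star_def, star_dotProduct, dotProduct_comm]

theorem ω_eq : ω = ⟨-1 / 2, √3 / 2⟩ := by
  have h : (2 * Real.pi * Complex.I / 3 : ℂ) = ((Real.pi - Real.pi / 3 : ℝ) : ℂ) * Complex.I := by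
    push_cast; ring
  rw [ω, h, Complex.exp_mul_I, ← Complex.ofReal_cos, ← Complex.ofReal_sin, Real.cos_pi_sub,
    Real.sin_pi_sub, Real.cos_pi_div_three, Real.sin_pi_div_three]
  apply Complex.ext <;> simp [neg_div]

theorem ω_sq : ω ^ 2 = ⟨-1 / 2, -(√3 / 2)⟩ := by
  have h : √3 * √3 = 3 := Real.mul_self_sqrt (by norm_num)
  rw [ω_eq]
  apply Complex.ext <;> simp [sq] <;> linarith

theorem ξ_eq : ξ = ⟨1 / 2, √3 / 2⟩ := by
  have h : (Real.pi * Complex.I / 3 : ℂ) = ((Real.pi / 3 : ℝ) : ℂ) * Complex.I := by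
    push_cast; ring
  rw [ξ, h, Complex.exp_mul_I, ← Complex.ofReal_cos, ← Complex.ofReal_sin,
    Real.cos_pi_div_three, Real.sin_pi_div_three]
  apply Complex.ext <;> simp

/-- The indices of the four MUB vectors orthogonal to a given SIC vector. -/
def sicMubOrthogonal : Fin 9 → Finset (Fin 12) :=
  ![{0, 3, 6, 9}, {0, 4, 7, 11}, {0, 5, 8, 10},
    {1, 3, 7, 10}, {1, 4, 8, 9}, {1, 5, 6, 11},
    {2, 3, 8, 11}, {2, 4, 6, 10}, {2, 5, 7, 9}]

set_option maxHeartbeats 1000000 in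
theorem normSq_sic3Vecs_dotProduct_mub3Vecs (y : Fin 9) (x : Fin 12) :
    Complex.normSq (sic3Vecs y ⬝ᵥ star (mub3Vecs x)) =
      if x ∈ sicMubOrthogonal y then 0 else 1 / 2 := by
  have h2 : (√2)⁻¹ ^ 2 = 1 / 2 := by rw [inv_pow, Real.sq_sqrt (by norm_num)]; norm_num
  have h3 : (√3)⁻¹ ^ 2 = 1 / 3 := by rw [inv_pow, Real.sq_sqrt (by norm_num)]; norm_num
  have ht2 : √3 ^ 2 = 3 := Real.sq_sqrt (by norm_num)
  have ht4 : √3 ^ 4 = 9 := by rw [show 4 = 2 * 2 from rfl, pow_mul, ht2]; norm_num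
  rw [mub3Vecs, sic3Vecs, ← Complex.ofReal_inv, ← Complex.ofReal_inv, ω_sq, ω_eq, ξ_eq]
  generalize (√2)⁻¹ = a at *
  generalize (√3)⁻¹ = b at *
  generalize √3 = t at *
  fin_cases y <;> fin_cases x <;>
    simp [sicMubOrthogonal, dotProduct, Fin.sum_univ_three, Complex.normSq_apply,
      -mul_eq_zero, -map_eq_zero] <;>
    ring_nf <;> norm_num [h2, h3, ht2, ht4]

theorem sic3_mub3_joint (y : Fin 9) (x : Fin 12) :
    (((1 / 9 : ℂ) • outerProd (sic3Vecs y)) *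
      ((1 / 4 : ℂ) • outerProd (mub3Vecs x))).trace.re =
      if x ∈ sicMubOrthogonal y then 0 else 1 / 72 := by
  have h : (((1 / 9 : ℂ) • outerProd (sic3Vecs y)) *
      ((1 / 4 : ℂ) • outerProd (mub3Vecs x))).trace =
      ((1 / 36 * Complex.normSq (sic3Vecs y ⬝ᵥ star (mub3Vecs x)) : ℝ) : ℂ) := by
    rw [smul_mul_smul_comm, trace_smul, trace_outerProd_mul_outerProd, smul_eq_mul]
    push_cast
    ring
  rw [h, Complex.ofReal_re, normSq_sic3Vecs_dotProduct_mub3Vecs]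
  split_ifs <;> norm_num

/-- The mutual information between the 3-dimensional SIC ensemble
`F = {(1/9)|ψ_y⟩⟨ψ_y|}` and the 4-MUB POVM `P = {(1/4)|φ_x⟩⟨φ_x|}` equals exactly
`log₂(3/2)`; this attains the 2-design upper bound on the informational power. -/
theorem sic3_ensemble_mub_povm_mutual_info :
    mutualInfo (fun y x =>
        (((1 / 9 : ℂ) • outerProd (sic3Vecs y)) *
          ((1 / 4 : ℂ) • outerProd (mub3Vecs x))).trace.re)
      = Real.logb 2 (3 / 2) := by
  have row (y : Fin 9) : #{x | x ∉ sicMubOrthogonal y} = 8 := by revert y; decide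
  have col (x : Fin 12) : #{y | x ∉ sicMubOrthogonal y} = 6 := by revert x; decide
  have hp (y : Fin 9) (x : Fin 12) : (if x ∈ sicMubOrthogonal y then (0 : ℝ) else 1 / 72) =
      if x ∉ sicMubOrthogonal y then 1 / 72 else 0 := (ite_not _ _ _).symm
  have hrow (y : Fin 9) :
      ∑ x, (if x ∉ sicMubOrthogonal y then (1 / 72 : ℝ) else 0) = 1 / 9 := by
    rw [← sum_filter, sum_const, row]; norm_num
  have hcol (x : Fin 12) :
      ∑ y, (if x ∉ sicMubOrthogonal y then (1 / 72 : ℝ) else 0) = 1 / 12 := by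
    rw [← sum_filter, sum_const, col]; norm_num
  have hterm (y : Fin 9) (x : Fin 12) :
      (if x ∉ sicMubOrthogonal y then (1 / 72 : ℝ) else 0) *
        Real.logb 2 ((if x ∉ sicMubOrthogonal y then (1 / 72 : ℝ) else 0) / (1 / 9 * (1 / 12))) =
      (if x ∉ sicMubOrthogonal y then (1 / 72 : ℝ) else 0) * Real.logb 2 (3 / 2) := by
    split_ifs
    · simp
    · rw [show (1 / 72 : ℝ) / (1 / 9 * (1 / 12)) = 3 / 2 by norm_num]
  simp only [mutualInfo, sic3_mub3_joint, hp, hrow, hcol, hterm, ← sum_mul]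
  simp
end

section
/- Let d ≥ 2, let 1/d³ ≤ a ≤ 1/d², and let {ρ_x}_{x=1}^{d²} be a d-dimensional arbitrary-rank SIC set: each ρ_x is a positive semidefinite d×d complex matrix with Tr[ρ_x] = 1, Σ_x ρ_x = d·I, and Tr[ρ_x ρ_{x'}] = d²a if x = x' and d(1 − da)/(d² − 1) if x ≠ x'. Let P = {Π_y = (1/d)ρ_y} be the associated arbitrary-rank SIC POVM. Then for every ensemble F in dimension d, the mutual information satisfies I(F, P) ≤ log₂( d(d²a + 1)/(d+1) ); i.e., the informational power of any arbitrary-rank SIC POVM is at most log₂( d(d²a + 1)/(d+1) ). -/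
open Matrix Finset
open scoped BigOperators ComplexOrder

/-- `ρ` is a `d`-dimensional arbitrary-rank SIC set with parameter `a`:
`d²` unit-trace PSD matrices summing to `d·I` whose pairwise Hilbert-Schmidt inner
products are `d²a` on the diagonal and `d(1−da)/(d²−1)` off the diagonal. -/
noncomputable def IsGenSIC (d : ℕ) (a : ℝ) (ρ : Fin (d ^ 2) → Matrix (Fin d) (Fin d) ℂ) :
    Prop :=
  (∀ x, (ρ x).PosSemidef) ∧ (∀ x, (ρ x).trace = 1) ∧
  (∑ x, ρ x = (d : ℂ) • 1) ∧
  (∀ x x', (ρ x * ρ x').trace =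
    if x = x' then ((d : ℂ) ^ 2 * (a : ℂ))
    else ((d : ℂ) * (1 - (d : ℂ) * (a : ℂ)) / ((d : ℂ) ^ 2 - 1)))

/-- The mutual information is at most `logb 2 K` as soon as every row of the joint distribution
has second moment at most `K / |Y|` times the square of its sum. -/
lemma mutualInfo_le_logb {X Y : Type*} [Fintype X] [Fintype Y] [Nonempty Y] {p : X → Y → ℝ}
    {K : ℝ} (hp : ∀ x y, 0 ≤ p x y) (hsum : ∑ x, ∑ y, p x y = 1) (hK : 0 < K)
    (hrow : ∀ x, Fintype.card Y * ∑ y, p x y ^ 2 ≤ K * (∑ y, p x y) ^ 2) :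
    mutualInfo p ≤ Real.logb 2 K := by
  set n : ℝ := (Fintype.card Y : ℝ)
  have hn : 0 < n := by simp only [n]; exact_mod_cast Fintype.card_pos
  set t : X → ℝ := fun x => ∑ y, p x y
  set q : Y → ℝ := fun y => ∑ x, p x y
  have hterm : ∀ x y, p x y * Real.log (p x y / (t x * q y)) - p x y * Real.log K ≤
      n / (t x * K) * p x y ^ 2 + p x y / (n * q y) - 2 * p x y := by
    intro x y
    rcases (hp x y).eq_or_lt with h | h
    · simp [← h]
    have ht0 : 0 < t x := h.trans_le (single_le_sum (fun y _ => hp x y) (mem_univ y))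
    have hq0 : 0 < q y :=
      h.trans_le (single_le_sum (f := fun x => p x y) (fun x _ => hp x y) (mem_univ x))
    have hsplit : Real.log (p x y / (t x * q y)) - Real.log K =
        Real.log (p x y * n / (t x * K)) + Real.log (1 / (n * q y)) := by
      rw [← Real.log_div (by positivity) hK.ne', ← Real.log_mul (by positivity) (by positivity)]
      congr 1
      field_simp
    have h1 := Real.log_le_sub_one_of_pos (show 0 < p x y * n / (t x * K) by positivity)
    have h2 := Real.log_le_sub_one_of_pos (show 0 < 1 / (n * q y) by positivity)
    calc _ = p x y * (Real.log (p x y / (t x * q y)) - Real.log K) := by ring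
      _ ≤ p x y * (p x y * n / (t x * K) - 1 + (1 / (n * q y) - 1)) := by
        rw [hsplit]; gcongr
      _ = _ := by ring
  have hfirst : ∑ x, ∑ y, n / (t x * K) * p x y ^ 2 ≤ 1 := by
    rw [← hsum]
    refine sum_le_sum fun x _ => ?_
    rw [← mul_sum]
    change _ ≤ t x
    have ht0 : 0 ≤ t x := sum_nonneg fun y _ => hp x y
    rcases ht0.eq_or_lt with h | h
    · simp [← h]
    · rw [div_mul_eq_mul_div, div_le_iff₀ (by positivity)]
      linarith [hrow x]
  have hsecond : ∑ x, ∑ y, p x y / (n * q y) ≤ 1 := by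
    rw [sum_comm]
    calc ∑ y, ∑ x, p x y / (n * q y) ≤ ∑ _y : Y, 1 / n := by
          refine sum_le_sum fun y _ => ?_
          rw [← sum_div]
          change q y / (n * q y) ≤ _
          rcases eq_or_ne (q y) 0 with h | h
          · simp [h, hn.le]
          · rw [div_le_div_iff₀ (by have : 0 ≤ q y := sum_nonneg fun x _ => hp x y
                                    positivity) hn]
            linarith
      _ = 1 := by
        rw [sum_const, card_univ, nsmul_eq_mul]
        exact mul_one_div_cancel hn.ne'
  have hlog : ∑ x, ∑ y, p x y * Real.log (p x y / (t x * q y)) - Real.log K ≤ 0 := by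
    have h := sum_le_sum fun x (_ : x ∈ univ) => sum_le_sum fun y (_ : y ∈ univ) => hterm x y
    simp only [sum_sub_distrib, sum_add_distrib, ← mul_sum, ← sum_mul] at h
    rw [show ∑ x, ∑ y, p x y = 1 from hsum] at h
    simp only [← mul_sum] at hfirst
    linarith
  have hmi : mutualInfo p =
      (∑ x, ∑ y, p x y * Real.log (p x y / (t x * q y))) / Real.log 2 := by
    simp only [mutualInfo, Real.logb, sum_div, mul_div_assoc, t, q]
  rw [hmi, Real.logb]
  have : 0 < Real.log 2 := Real.log_pos one_lt_two
  gcongr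
  linarith

namespace Matrix.PosSemidef

variable {n : Type*} [Fintype n]

open scoped MatrixOrder in
lemma trace_mul_re_nonneg {A B : Matrix n n ℂ} (hA : A.PosSemidef) (hB : B.PosSemidef) :
    0 ≤ (A * B).trace.re := by
  classical
  obtain ⟨C, rfl⟩ := CStarAlgebra.nonneg_iff_eq_star_mul_self.mp hB.nonneg
  rw [← Matrix.mul_assoc, trace_mul_comm, ← Matrix.mul_assoc]
  exact (Complex.nonneg_iff.mp (hA.mul_mul_conjTranspose_same C).trace_nonneg).1

lemma trace_mul_self_re_le_s14 {A : Matrix n n ℂ} (hA : A.PosSemidef) :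
    (A * A).trace.re ≤ A.trace.re ^ 2 := by
  classical
  have h : (A * A).trace = ∑ i, (hA.1.eigenvalues i : ℂ) ^ 2 := by
    conv_lhs => rw [hA.1.spectral_theorem]
    rw [← map_mul, Unitary.conjStarAlgAut_apply, trace_mul_cycle,
      Unitary.coe_star_mul_self, one_mul, diagonal_mul_diagonal, trace_diagonal]
    simp [sq]
  rw [h, hA.1.trace_eq_sum_eigenvalues]
  have := sum_sq_le_sq_sum_of_nonneg (s := univ) fun i _ => hA.eigenvalues_nonneg i
  simpa [← Complex.ofReal_pow] using this

end Matrix.PosSemidef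

/-- The frame bound of an arbitrary-rank SIC set on positive semidefinite matrices. -/
lemma IsGenSIC.sum_trace_mul_sq_le {d : ℕ} (hd : 2 ≤ d) {a : ℝ} (ha : 1 / (d : ℝ) ^ 3 ≤ a)
    {ρ : Fin (d ^ 2) → Matrix (Fin d) (Fin d) ℂ} (hρ : IsGenSIC d a ρ)
    {A : Matrix (Fin d) (Fin d) ℂ} (hA : A.PosSemidef) :
    ∑ y, (A * ρ y).trace.re ^ 2 ≤
      d * ((d : ℝ) ^ 2 * a + 1) / (d + 1) * A.trace.re ^ 2 := by
  obtain ⟨hpsd, htr, hone, hgram⟩ := hρ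
  have hd0 : (2 : ℝ) ≤ d := by exact_mod_cast hd
  have hdne : (d : ℝ) ≠ 0 := by positivity
  have hd1 : (d : ℝ) ^ 2 - 1 ≠ 0 := by nlinarith
  set t := A.trace.re
  set s : Fin (d ^ 2) → ℝ := fun y => (A * ρ y).trace.re - t / d with hs
  set S := ∑ y, s y ^ 2 with hS
  set N := (A * A).trace.re - t ^ 2 / d with hN
  set c : ℝ := d * (d ^ 3 * a - 1) / (d ^ 2 - 1) with hc
  set V := ∑ y, s y • ρ y with hV
  have hgram' : ∀ x y, (ρ x * ρ y).trace.re =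
      d * (1 - d * a) / (d ^ 2 - 1) + if x = y then c else 0 := by
    intro x y
    have : (ρ x * ρ y).trace = ((if x = y then (d : ℝ) ^ 2 * a
        else d * (1 - d * a) / (d ^ 2 - 1) : ℝ) : ℂ) := by
      rw [hgram]; split_ifs <;> push_cast <;> rfl
    rw [this, Complex.ofReal_re]
    split_ifs
    · rw [hc]; field_simp; ring
    · ring
  have hrow : ∑ y, (A * ρ y).trace.re = d * t := by
    rw [← Complex.re_sum, ← trace_sum, ← Matrix.mul_sum, hone]
    simp [t]
  have hssum : ∑ y, s y = 0 := by
    simp only [hs, sum_sub_distrib, hrow, sum_const, card_univ, Fintype.card_fin, nsmul_eq_mul]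
    push_cast; field_simp; ring
  have hVtr : V.trace.re = 0 := by
    simp [hV, trace_sum, htr, hssum]
  have hAV : (A * V).trace.re = S := by
    have : (A * V).trace.re = ∑ y, s y * (s y + t / d) := by
      simp [hV, Matrix.mul_sum, trace_sum, hs]
    rw [this]
    simp only [mul_add, sum_add_distrib, ← sum_mul, hssum, hS, sq]
    ring
  have hVV : (V * V).trace.re = c * S := by
    have : (V * V).trace.re = ∑ x, ∑ y, s x * (s y * (ρ x * ρ y).trace.re) := by
      simp [hV, Matrix.sum_mul, trace_sum, mul_sum]
      rw [sum_comm]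
      exact sum_congr rfl fun _ _ => sum_congr rfl fun _ _ => by ring
    rw [this]
    simp only [hgram', mul_add, sum_add_distrib, ← sum_mul, ← mul_sum, hssum]
    simp [hS, mul_sum]
    exact sum_congr rfl fun _ _ => by ring
  have hVherm : V.IsHermitian := by
    simp only [hV, IsHermitian, conjTranspose_sum, conjTranspose_smul, (hpsd _).1.eq, star_trivial]
  have hquad : ∀ l : ℝ, 0 ≤ N * (l * l) + (-2 * S) * l + c * S := by
    intro l
    have hB : (l • (A - (t / d) • 1) - V).IsHermitian := by
      simp only [IsHermitian, conjTranspose_sub, conjTranspose_smul, hA.1.eq, hVherm.eq,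
        conjTranspose_one, star_trivial]
    have h := (Complex.nonneg_iff.mp
      (posSemidef_conjTranspose_mul_self (l • (A - (t / d) • 1) - V)).trace_nonneg).1
    have hVA : (V * A).trace.re = S := by rw [trace_mul_comm, hAV]
    have hexp : ((l • (A - (t / d) • 1) - V) * (l • (A - (t / d) • 1) - V)).trace.re =
        N * (l * l) + (-2 * S) * l + c * S := by
      simp [mul_sub, sub_mul, hAV, hVA, hVV, hVtr]
      rw [hN]
      field_simp
      ring
    rwa [hB.eq, hexp] at h
  have hdisc := discrim_le_zero hquad
  rw [discrim] at hdisc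
  have hS0 : 0 ≤ S := sum_nonneg fun y _ => sq_nonneg _
  have hc0 : 0 ≤ c := by
    rw [div_le_iff₀ (by positivity)] at ha
    exact div_nonneg (mul_nonneg (by positivity) (by linarith)) (by nlinarith)
  have hN0 : N ≤ t ^ 2 - t ^ 2 / d := sub_le_sub_right hA.trace_mul_self_re_le_s14 _
  have hSN : S ≤ c * (t ^ 2 - t ^ 2 / d) := by
    rcases hS0.eq_or_lt with h | h
    · rw [← h]
      refine mul_nonneg hc0 (sub_nonneg.mpr (div_le_self (sq_nonneg t) (by linarith)))
    · refine le_trans ?_ (mul_le_mul_of_nonneg_left hN0 hc0)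
      nlinarith
  have hexpand : ∑ y, (A * ρ y).trace.re ^ 2 = S + t ^ 2 := by
    have : ∀ y, (A * ρ y).trace.re ^ 2 = s y ^ 2 + 2 * (t / d) * s y + (t / d) ^ 2 := by
      intro y; simp only [hs]; ring
    simp only [this, sum_add_distrib, ← mul_sum, hssum, sum_const, card_univ, Fintype.card_fin,
      nsmul_eq_mul]
    push_cast; field_simp; ring
  rw [hexpand]
  calc S + t ^ 2 ≤ c * (t ^ 2 - t ^ 2 / d) + t ^ 2 := by linarith
    _ = _ := by
      rw [hc]; field_simp; ring

/-- Informational power bound for arbitrary-rank SIC POVMs: for the POVM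
`P = {(1/d)ρ_y}` and any ensemble `{σ_x}`, the mutual information satisfies
`I(F,P) ≤ log₂(d(d²a + 1)/(d+1))`. -/
theorem informational_power_bound_gen_sic {d : ℕ} (hd : 2 ≤ d) (a : ℝ)
    (ha1 : 1 / (d : ℝ) ^ 3 ≤ a) (ha2 : a ≤ 1 / (d : ℝ) ^ 2)
    (ρ : Fin (d ^ 2) → Matrix (Fin d) (Fin d) ℂ) (hρ : IsGenSIC d a ρ)
    {m : ℕ} (σ : Fin m → Matrix (Fin d) (Fin d) ℂ)
    (hσpsd : ∀ x, (σ x).PosSemidef) (hσtr : ∑ x, (σ x).trace = 1) :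
    mutualInfo (fun x y => (σ x * (((d : ℂ))⁻¹ • ρ y)).trace.re)
      ≤ Real.logb 2 ((d : ℝ) * ((d : ℝ) ^ 2 * a + 1) / ((d : ℝ) + 1)) := by
  have hd0 : (2 : ℝ) ≤ d := by exact_mod_cast hd
  have hdne : (d : ℝ) ≠ 0 := by positivity
  have hpos : 0 ≤ a := le_trans (by positivity) ha1
  have : Nonempty (Fin (d ^ 2)) := ⟨⟨0, by positivity⟩⟩
  have hp : ∀ x y, (σ x * (((d : ℂ))⁻¹ • ρ y)).trace.re = (d : ℝ)⁻¹ * (σ x * ρ y).trace.re := by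
    intro x y
    rw [mul_smul_comm, trace_smul, smul_eq_mul, ← Complex.ofReal_natCast, ← Complex.ofReal_inv,
      Complex.re_ofReal_mul]
  have hrow : ∀ x, ∑ y, (d : ℝ)⁻¹ * (σ x * ρ y).trace.re = (σ x).trace.re := by
    intro x
    rw [← mul_sum, ← Complex.re_sum, ← trace_sum, ← Matrix.mul_sum, hρ.2.2.1]
    simp [hdne]
  simp only [hp]
  refine mutualInfo_le_logb ?_ ?_ (by positivity) ?_
  · exact fun x y => mul_nonneg (by positivity) ((hσpsd x).trace_mul_re_nonneg (hρ.1 y))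
  · simp only [hrow, ← Complex.re_sum, hσtr, Complex.one_re]
  · intro x
    rw [hrow]
    refine le_trans (le_of_eq ?_) (hρ.sum_trace_mul_sq_le hd ha1 (hσpsd x))
    simp only [mul_pow, ← mul_sum, Fintype.card_fin]
    push_cast; field_simp
end
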